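/- arXiv:2512.02525 — 2 statements merged into one kernel-verified Lean document; each statement's English description precedes it below -/
import Mathlib

section
/- Let G be a discrete group and ((A^(i), G, α^(i)), φ_i)_{i∈ℕ} an inductive sequence of partial dynamical systems. Suppose that for each i: B^(i) is a C*-algebra containing A^(i) as a closed two-sided ideal; η^(i) is a global action of G on B^(i) that is a globalization of α^(i); and ψ_i : B^(i) → B^(i+1) is a *-homomorphism with ψ_i|_{A^(i)} = φ_i and ψ_i∘η^(i)_g = η^(i+1)_g∘ψ_i for all g ∈ G. Let (B, (ν_i)_{i∈ℕ}) be a concrete inductive limit of (B^(i), ψ_i), and let η be a global action of G on B satisfying η_g(ν_i(b)) = ν_i(η^(i)_g(b)) for all i, all g ∈ G and all b ∈ B^(i). Set A := closure(⋃_i ν_i(A^(i))) and, for g ∈ G, A_g := closure(⋃_i ν_i(A^(i)_g)). Then η is a globalization of the inductive limit partial action: (a) A is a closed two-sided ideal of B; (b) for every g ∈ G, A_g = A ∩ η_g(A) and η_g(ν_i(a)) = ν_i(α^(i)_g(a)) for every i and a ∈ A^(i)_{g⁻¹}; (c) B equals the closed linear span of ⋃_{g∈G} η_g(A). -/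
/-- A global action of a discrete group `G` on a C*-algebra `B`: a group homomorphism
from `G` into the *-automorphisms of `B`, encoded elementwise. -/
def IsGlobalAction {G : Type*} [Group G] {B : Type*}
    [NonUnitalNormedRing B] [StarRing B] [Module ℂ B] (η : G → B → B) : Prop :=
  (∀ (g : G) (a b : B), η g (a + b) = η g a + η g b) ∧
  (∀ (g : G) (c : ℂ) (a : B), η g (c • a) = c • η g a) ∧
  (∀ (g : G) (a b : B), η g (a * b) = η g a * η g b) ∧
  (∀ (g : G) (a : B), η g (star a) = star (η g a)) ∧
  (∀ a : B, η 1 a = a) ∧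
  (∀ (g h : G) (a : B), η (g * h) a = η g (η h a))

/-- `S` is a closed two-sided ideal of the C*-algebra `B` (closed under the ℂ-module
structure as well). -/
def IsClosedTwoSidedIdeal {B : Type*}
    [NonUnitalNormedRing B] [Module ℂ B] (S : Set B) : Prop :=
  IsClosed S ∧ (0 : B) ∈ S ∧ (∀ a ∈ S, ∀ b ∈ S, a + b ∈ S) ∧
  (∀ (c : ℂ), ∀ a ∈ S, c • a ∈ S) ∧
  (∀ x : B, ∀ a ∈ S, x * a ∈ S ∧ a * x ∈ S)

/-- The global action `η` of `G` on `B` is a globalization of its restriction to the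
closed two-sided ideal `S ⊆ B`: `B` is the closed linear span of `⋃ g, η g '' S`. -/
def IsGlobalization {G : Type*} [Group G] {B : Type*}
    [NonUnitalNormedRing B] [StarRing B] [Module ℂ B] (η : G → B → B) (S : Set B) : Prop :=
  IsGlobalAction η ∧ IsClosedTwoSidedIdeal S ∧
  closure (Submodule.span ℂ (⋃ g : G, η g '' S) : Set B) = Set.univ

/-- `φ` (defined on the ideal `S₁ ⊆ B₁`) is a *-homomorphism from `S₁` to `S₂` that is
`G`-equivariant with respect to the restricted partial actions: recall that the
restriction of `η` to `S` has ideals `S ∩ η g '' S` and maps `η g` restricted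
to `S ∩ η g⁻¹ '' S`. -/
def IsEquivariantIdealHom {G : Type*} [Group G] {B₁ B₂ : Type*}
    [NonUnitalNormedRing B₁] [StarRing B₁] [Module ℂ B₁]
    [NonUnitalNormedRing B₂] [StarRing B₂] [Module ℂ B₂]
    (η₁ : G → B₁ → B₁) (S₁ : Set B₁) (η₂ : G → B₂ → B₂) (S₂ : Set B₂)
    (φ : B₁ → B₂) : Prop :=
  Set.MapsTo φ S₁ S₂ ∧
  (∀ a ∈ S₁, ∀ b ∈ S₁, φ (a + b) = φ a + φ b) ∧
  (∀ (c : ℂ), ∀ a ∈ S₁, φ (c • a) = c • φ a) ∧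
  (∀ a ∈ S₁, ∀ b ∈ S₁, φ (a * b) = φ a * φ b) ∧
  (∀ a ∈ S₁, φ (star a) = star (φ a)) ∧
  (∀ g : G, φ '' (S₁ ∩ η₁ g '' S₁) ⊆ S₂ ∩ η₂ g '' S₂) ∧
  (∀ g : G, ∀ a ∈ S₁ ∩ η₁ g⁻¹ '' S₁, φ (η₁ g a) = η₂ g (φ a))

/-- The composite `ψ_{i,i+j} = ψ_{i+j-1} ∘ ⋯ ∘ ψ_i : B_i → B_{i+j}` of the connecting maps
of an inductive sequence. -/
def iterMap {B : ℕ → Type*} (ψ : ∀ i, B i → B (i + 1)) (i : ℕ) : (j : ℕ) → B i → B (i + j)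
  | 0 => id
  | j + 1 => fun b => ψ (i + j) (iterMap ψ i j b)

theorem IsGlobalAction.apply_inv_apply {G : Type*} [Group G] {B : Type*}
    [NonUnitalNormedRing B] [StarRing B] [Module ℂ B] {η : G → B → B}
    (h : IsGlobalAction η) (g : G) (x : B) : η g (η g⁻¹ x) = x := by
  obtain ⟨-, -, -, -, h1, hm⟩ := h
  rw [← hm, mul_inv_cancel, h1]

theorem IsGlobalAction.image_eq_preimage {G : Type*} [Group G] {B : Type*}
    [NonUnitalNormedRing B] [StarRing B] [Module ℂ B] {η : G → B → B}
    (h : IsGlobalAction η) (g : G) (S : Set B) : η g '' S = η g⁻¹ ⁻¹' S := by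
  refine congrFun (Set.image_eq_preimage_of_inverse (fun x => ?_) (fun x => ?_)) S
  · simpa using h.apply_inv_apply g⁻¹ x
  · exact h.apply_inv_apply g x

open scoped CStarAlgebra in
theorem NonUnitalStarAlgHom.continuous_of_cstarAlgebra {A B : Type*}
    [NonUnitalCStarAlgebra A] [NonUnitalCStarAlgebra B] (f : A →⋆ₙₐ[ℂ] B) : Continuous f :=
  map_continuous f

theorem IsGlobalAction.continuous {G : Type*} [Group G] {B : Type*}
    [NonUnitalCStarAlgebra B] {η : G → B → B} (h : IsGlobalAction η) (g : G) :
    Continuous (η g) := by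
  obtain ⟨ha, hs, hm, hst, -, -⟩ := h
  let f : B →⋆ₙₐ[ℂ] B :=
    { toFun := η g
      map_smul' := hs g
      map_zero' := by simpa using hs g 0 0
      map_add' := ha g
      map_mul' := hm g
      map_star' := hst g }
  exact f.continuous_of_cstarAlgebra

theorem IsGlobalAction.isClosedTwoSidedIdeal_image {G : Type*} [Group G] {B : Type*}
    [NonUnitalCStarAlgebra B] {η : G → B → B} (h : IsGlobalAction η) (g : G) {S : Set B}
    (hS : IsClosedTwoSidedIdeal S) : IsClosedTwoSidedIdeal (η g '' S) := by
  rw [h.image_eq_preimage]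
  have hc := h.continuous g⁻¹
  obtain ⟨ha, hs, hm, -, -, -⟩ := h
  obtain ⟨hcl, h0, hadd, hsmul, hmul⟩ := hS
  refine ⟨hcl.preimage hc, ?_, fun a ha' b hb' => ?_, fun c a ha' => ?_,
    fun x a ha' => ⟨?_, ?_⟩⟩
  · have : η g⁻¹ 0 = 0 := by simpa using hs g⁻¹ 0 0
    simpa [this] using h0
  · simpa only [Set.mem_preimage, ha] using hadd _ ha' _ hb'
  · simpa only [Set.mem_preimage, hs] using hsmul c _ ha'
  · simpa only [Set.mem_preimage, hm] using (hmul _ _ ha').1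
  · simpa only [Set.mem_preimage, hm] using (hmul _ _ ha').2

theorem norm_sub_mul_star_mul_cfcₙ_sq_le {B : Type*} [NonUnitalCStarAlgebra B] (x : B)
    {δ : ℝ} (hδ : 0 < δ) :
    ‖x - x * (star x * x * cfcₙ (fun t : ℝ => t / (t ^ 2 + δ ^ 2)) (star x * x))‖ ^ 2 ≤ δ := by
  set a := star x * x with ha
  have hsa : IsSelfAdjoint a := IsSelfAdjoint.star_mul_self x
  have hpos (t : ℝ) : 0 < t ^ 2 + δ ^ 2 := by positivity
  have hg : Continuous (fun t : ℝ => t / (t ^ 2 + δ ^ 2)) :=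
    continuous_id.div (by fun_prop) fun t => (hpos t).ne'
  set e := a * cfcₙ (fun t : ℝ => t / (t ^ 2 + δ ^ 2)) a
  have hf : Continuous (fun t : ℝ => t * (t / (t ^ 2 + δ ^ 2))) := continuous_id.mul hg
  have he' : e = cfcₙ (fun t : ℝ => t * (t / (t ^ 2 + δ ^ 2))) a := by
    rw [cfcₙ_mul (fun t : ℝ => t) _ a continuousOn_id rfl hg.continuousOn (by simp),
      cfcₙ_id' ℝ a]
  have hes : star e = e := by rw [he']; exact (cfcₙ_predicate (R := ℝ) _ a)
  have hae : a - a * e = cfcₙ (fun t : ℝ => t - t * (t * (t / (t ^ 2 + δ ^ 2)))) a := by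
    rw [cfcₙ_sub (fun t : ℝ => t) (fun t => t * (t * (t / (t ^ 2 + δ ^ 2)))) a
        continuousOn_id rfl (continuous_id.mul hf).continuousOn (by simp),
      cfcₙ_mul (fun t : ℝ => t) _ a continuousOn_id rfl hf.continuousOn (by simp),
      cfcₙ_id' ℝ a, he']
  have hkey : star (x - x * e) * (x - x * e) =
      cfcₙ (fun t : ℝ => (t - t * (t * (t / (t ^ 2 + δ ^ 2)))) -
        t * (t / (t ^ 2 + δ ^ 2)) * (t - t * (t * (t / (t ^ 2 + δ ^ 2))))) a := by
    have hd : Continuous (fun t : ℝ => t - t * (t * (t / (t ^ 2 + δ ^ 2)))) :=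
      continuous_id.sub (continuous_id.mul hf)
    rw [cfcₙ_sub _ (fun t : ℝ => t * (t / (t ^ 2 + δ ^ 2)) *
        (t - t * (t * (t / (t ^ 2 + δ ^ 2))))) a hd.continuousOn (by simp)
        (hf.mul hd).continuousOn (by simp),
      cfcₙ_mul _ _ a hf.continuousOn (by simp) hd.continuousOn (by simp), ← hae, ← he',
      star_sub, star_mul, hes, ha]
    noncomm_ring
  rw [sq, ← CStarRing.norm_star_mul_self, hkey]
  refine norm_cfcₙ_le fun t _ => ?_
  have h1 : (t - t * (t * (t / (t ^ 2 + δ ^ 2)))) -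
        t * (t / (t ^ 2 + δ ^ 2)) * (t - t * (t * (t / (t ^ 2 + δ ^ 2)))) =
      t * δ ^ 4 / (t ^ 2 + δ ^ 2) ^ 2 := by
    have := (hpos t).ne'
    field_simp
    ring
  rw [h1, Real.norm_eq_abs, abs_div, abs_mul, abs_of_pos (pow_pos (hpos t) 2),
    abs_of_pos (pow_pos hδ 4), div_le_iff₀ (pow_pos (hpos t) 2), ← sq_abs t]
  have h2 : |t| * δ ≤ |t| ^ 2 + δ ^ 2 := by nlinarith [sq_nonneg (|t| - δ), sq_nonneg |t|]
  have h3 : δ ^ 2 ≤ |t| ^ 2 + δ ^ 2 := by nlinarith [sq_nonneg |t|]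
  calc |t| * δ ^ 4 = δ * ((|t| * δ) * δ ^ 2) := by ring
    _ ≤ δ * ((|t| ^ 2 + δ ^ 2) * (|t| ^ 2 + δ ^ 2)) := by gcongr
    _ = δ * (|t| ^ 2 + δ ^ 2) ^ 2 := by ring

theorem IsClosedTwoSidedIdeal.mem_closure_image_mul {B : Type*} [NonUnitalCStarAlgebra B]
    {J : Set B} (hJ : IsClosedTwoSidedIdeal J) {x : B} (hx : x ∈ J) :
    x ∈ closure ((fun e => x * e) '' J) := by
  rw [Metric.mem_closure_iff]
  intro ε hε
  refine ⟨_, ⟨_, (hJ.2.2.2.2 (cfcₙ (fun t : ℝ => t / (t ^ 2 + (ε ^ 2 / 2) ^ 2)) (star x * x))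
    _ (hJ.2.2.2.2 (star x) x hx).1).2, rfl⟩, ?_⟩
  · rw [dist_eq_norm]
    have := norm_sub_mul_star_mul_cfcₙ_sq_le x (δ := ε ^ 2 / 2) (by positivity)
    refine lt_of_pow_lt_pow_left₀ 2 hε.le (this.trans_lt ?_)
    have := pow_pos hε 2
    linarith

theorem IsClosedTwoSidedIdeal.closure_iUnion_image {B : ℕ → Type*}
    [∀ i, NonUnitalCStarAlgebra (B i)] {L : Type*} [NonUnitalCStarAlgebra L]
    {S : ∀ i, Set (B i)} (hS : ∀ i, IsClosedTwoSidedIdeal (S i))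
    {ν : ∀ i, B i →⋆ₙₐ[ℂ] L} (hmonoS : Monotone fun i => ν i '' S i)
    (hmono : Monotone fun i => Set.range (ν i))
    (hdense : closure (⋃ i, Set.range (ν i)) = Set.univ) :
    IsClosedTwoSidedIdeal (closure (⋃ i, ν i '' S i)) := by
  have hmul : ∀ x ∈ ⋃ i, Set.range (ν i), ∀ a ∈ ⋃ i, ν i '' S i,
      x * a ∈ (⋃ i, ν i '' S i) ∧ a * x ∈ ⋃ i, ν i '' S i := by
    intro x hx a ha
    obtain ⟨i, hi⟩ := Set.mem_iUnion.1 hx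
    obtain ⟨j, hj⟩ := Set.mem_iUnion.1 ha
    obtain ⟨b, rfl⟩ := hmono (le_max_left i j) hi
    obtain ⟨c, hc, rfl⟩ := hmonoS (le_max_right i j) hj
    have := (hS (max i j)).2.2.2.2 b c hc
    exact ⟨Set.mem_iUnion.2 ⟨_, _, this.1, map_mul _ _ _⟩,
      Set.mem_iUnion.2 ⟨_, _, this.2, map_mul _ _ _⟩⟩
  refine ⟨isClosed_closure,
    subset_closure (Set.mem_iUnion.2 ⟨0, 0, (hS 0).2.1, map_zero _⟩),
    fun a ha b hb => map_mem_closure₂ continuous_add ha hb ?_,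
    fun c a ha => map_mem_closure (continuous_const_smul c) ha ?_, fun x a ha => ?_⟩
  · intro a ha b hb
    obtain ⟨i, hi⟩ := Set.mem_iUnion.1 ha
    obtain ⟨j, hj⟩ := Set.mem_iUnion.1 hb
    obtain ⟨a, ha', rfl⟩ := hmonoS (le_max_left i j) hi
    obtain ⟨b, hb', rfl⟩ := hmonoS (le_max_right i j) hj
    exact Set.mem_iUnion.2 ⟨_, _, (hS _).2.2.1 a ha' b hb', map_add _ _ _⟩
  · intro a ha
    obtain ⟨i, a, ha', rfl⟩ := Set.mem_iUnion.1 ha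
    exact Set.mem_iUnion.2 ⟨_, _, (hS _).2.2.2.1 c a ha', map_smul _ _ _⟩
  · have hx : x ∈ closure (⋃ i, Set.range (ν i)) := hdense ▸ Set.mem_univ x
    exact ⟨map_mem_closure₂ continuous_mul hx ha fun x hx a ha => (hmul x hx a ha).1,
      map_mem_closure₂ continuous_mul ha hx fun a ha x hx => (hmul x hx a ha).2⟩

variable
    {G : Type*} [Group G]
    {B : ℕ → Type*} [∀ i, NonUnitalCStarAlgebra (B i)]
    {L : Type*} [NonUnitalCStarAlgebra L]

/-- Given an inductive sequence of partial dynamical systems in which each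
partial action `α⁽ⁱ⁾` is the restriction of a global action `η⁽ⁱ⁾` on `B⁽ⁱ⁾` to the closed
two-sided ideal `A⁽ⁱ⁾ = SA i`, equivariant connecting maps `ψᵢ` extending the `φᵢ`,
a concrete inductive limit `(L, ν)` of `(B⁽ⁱ⁾, ψᵢ)`, and a global action `ηL` of `G` on `L`
compatible with the `η⁽ⁱ⁾`, the action `ηL` is a globalization of the inductive limit
partial action on `A := closure (⋃ i, ν i '' SA i)`. -/
theorem globalization_of_inductive_limit_partial_action
    (SA : ∀ i, Set (B i)) (η : ∀ i, G → B i → B i)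
    (hglob : ∀ i, IsGlobalization (η i) (SA i))
    (ψ : ∀ i, B i →⋆ₙₐ[ℂ] B (i + 1))
    (hψφ : ∀ i, IsEquivariantIdealHom (η i) (SA i) (η (i + 1)) (SA (i + 1)) (ψ i))
    (hψη : ∀ (i : ℕ) (g : G) (b : B i), ψ i (η i g b) = η (i + 1) g (ψ i b))
    (ν : ∀ i, B i →⋆ₙₐ[ℂ] L)
    (hνψ : ∀ (i : ℕ) (b : B i), ν (i + 1) (ψ i b) = ν i b)
    (hdense : closure (⋃ i, Set.range (ν i)) = Set.univ)
    (hnorm : ∀ (i : ℕ) (b : B i),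
      Filter.Tendsto (fun j => ‖iterMap (fun i => ⇑(ψ i)) i j b‖) Filter.atTop
        (nhds ‖ν i b‖))
    (ηL : G → L → L) (hηL : IsGlobalAction ηL)
    (hηLν : ∀ (i : ℕ) (g : G) (b : B i), ηL g (ν i b) = ν i (η i g b)) :
    IsClosedTwoSidedIdeal (closure (⋃ i, ν i '' SA i)) ∧
    (∀ g : G,
      closure (⋃ i, ν i '' (SA i ∩ η i g '' SA i)) =
        closure (⋃ i, ν i '' SA i) ∩ ηL g '' closure (⋃ i, ν i '' SA i)) ∧
    (∀ (g : G) (i : ℕ), ∀ a ∈ SA i ∩ η i g⁻¹ '' SA i, ηL g (ν i a) = ν i (η i g a)) ∧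
    closure (Submodule.span ℂ (⋃ g : G, ηL g '' closure (⋃ i, ν i '' SA i)) : Set L) =
      Set.univ := by
  have hmonoS : Monotone fun i => ν i '' SA i := by
    refine monotone_nat_of_le_succ fun i => ?_
    rintro _ ⟨a, ha, rfl⟩
    exact ⟨ψ i a, (hψφ i).1 ha, hνψ i a⟩
  have hmono : Monotone fun i => Set.range (ν i) := by
    refine monotone_nat_of_le_succ fun i => ?_
    rintro _ ⟨a, rfl⟩
    exact ⟨ψ i a, hνψ i a⟩
  have hA : IsClosedTwoSidedIdeal (closure (⋃ i, ν i '' SA i)) :=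
    .closure_iUnion_image (fun i => (hglob i).2.1) hmonoS hmono hdense
  refine ⟨hA, fun g => ?_, fun g i a _ => hηLν i g a, ?_⟩
  · have hJ := hηL.isClosedTwoSidedIdeal_image g hA
    refine Set.Subset.antisymm (closure_minimal ?_ (hA.1.inter hJ.1)) ?_
    · refine Set.iUnion_subset fun i => ?_
      rintro _ ⟨_, ⟨ha, b, hb, rfl⟩, rfl⟩
      exact ⟨subset_closure (Set.mem_iUnion.2 ⟨i, _, ha, rfl⟩), ν i b,
        subset_closure (Set.mem_iUnion.2 ⟨i, b, hb, rfl⟩), hηLν i g b⟩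
    · rintro x ⟨hxA, hxJ⟩
      refine closure_minimal ?_ isClosed_closure (hJ.mem_closure_image_mul hxJ)
      rintro _ ⟨_, ⟨y, hy, rfl⟩, rfl⟩
      refine map_mem_closure₂ (f := fun u v => u * ηL g v)
        (continuous_fst.mul ((hηL.continuous g).comp continuous_snd)) hxA hy ?_
      intro u hu v hv
      obtain ⟨i, hi⟩ := Set.mem_iUnion.1 hu
      obtain ⟨j, hj⟩ := Set.mem_iUnion.1 hv
      obtain ⟨a, ha, rfl⟩ := hmonoS (le_max_left i j) hi
      obtain ⟨b, hb, rfl⟩ := hmonoS (le_max_right i j) hj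
      obtain ⟨hact, hid, -⟩ := hglob (max i j)
      refine Set.mem_iUnion.2 ⟨max i j, a * η _ g b, ⟨(hid.2.2.2.2 _ a ha).2, ?_⟩, ?_⟩
      · exact ((hact.isClosedTwoSidedIdeal_image g hid).2.2.2.2 a _ ⟨b, hb, rfl⟩).1
      · rw [map_mul, hηLν]
  · set T := Submodule.span ℂ (⋃ g : G, ηL g '' closure (⋃ i, ν i '' SA i))
    refine Set.eq_univ_of_univ_subset (hdense ▸ closure_minimal ?_ isClosed_closure)
    refine Set.iUnion_subset fun i => ?_
    rintro _ ⟨b, rfl⟩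
    have hb : b ∈ closure (Submodule.span ℂ (⋃ g : G, η i g '' SA i) : Set (B i)) :=
      (hglob i).2.2 ▸ Set.mem_univ b
    refine map_mem_closure (ν i).continuous_of_cstarAlgebra hb fun c hc => ?_
    refine Submodule.span_induction (p := fun c _ => ν i c ∈ T) ?_ ?_ ?_ ?_ hc
    · intro x hx
      obtain ⟨g, a, ha, rfl⟩ := Set.mem_iUnion.1 hx
      refine Submodule.subset_span (Set.mem_iUnion.2 ⟨g, ν i a, ?_, hηLν i g a⟩)
      exact subset_closure (Set.mem_iUnion.2 ⟨i, a, ha, rfl⟩)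
    · simp
    · intro x y _ _ hx hy
      rw [map_add]
      exact T.add_mem hx hy
    · intro r x _ hx
      rw [map_smul]
      exact T.smul_mem r hx
end

section
/- Let G be a discrete group and ((A^(i), G, α^(i)), φ_i)_{i∈ℕ} an inductive sequence of partial dynamical systems. Suppose that for each i: B^(i) is a C*-algebra containing A^(i) as a closed two-sided ideal; η^(i) is a global action of G on B^(i) that is a globalization of α^(i); and ψ_i : B^(i) → B^(i+1) is a *-homomorphism with ψ_i|_{A^(i)} = φ_i and ψ_i∘η^(i)_g = η^(i+1)_g∘ψ_i for all g ∈ G. Let (B, (ν_i)_{i∈ℕ}) be a concrete inductive limit of (B^(i), ψ_i), and let η be a global action of G on B satisfying η_g(ν_i(b)) = ν_i(η^(i)_g(b)) for all i, all g ∈ G and all b ∈ B^(i). Set A := closure(⋃_i ν_i(A^(i))). Then B equals the closed linear span of ⋃_{g∈G} η_g(A). -/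
variable
    {G : Type*} [Group G]
    {B : ℕ → Type*} [∀ i, NonUnitalCStarAlgebra (B i)]
    {L : Type*} [NonUnitalCStarAlgebra L]

/-- In the setting of an inductive sequence of partial dynamical systems
whose partial actions are restrictions of global actions `η⁽ⁱ⁾` on `B⁽ⁱ⁾` (globalizations),
with equivariant connecting maps `ψᵢ`, concrete inductive limit `(L, ν)` and compatible
global action `ηL` on `L`, the algebra `L` is the closed linear span of
`⋃ g, ηL g '' A` where `A := closure (⋃ i, ν i '' SA i)`. -/
theorem inductive_limit_closed_span_of_translates
    (SA : ∀ i, Set (B i)) (η : ∀ i, G → B i → B i)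
    (hglob : ∀ i, IsGlobalization (η i) (SA i))
    (ψ : ∀ i, B i →⋆ₙₐ[ℂ] B (i + 1))
    (hψφ : ∀ i, IsEquivariantIdealHom (η i) (SA i) (η (i + 1)) (SA (i + 1)) (ψ i))
    (hψη : ∀ (i : ℕ) (g : G) (b : B i), ψ i (η i g b) = η (i + 1) g (ψ i b))
    (ν : ∀ i, B i →⋆ₙₐ[ℂ] L)
    (hνψ : ∀ (i : ℕ) (b : B i), ν (i + 1) (ψ i b) = ν i b)
    (hdense : closure (⋃ i, Set.range (ν i)) = Set.univ)
    (hnorm : ∀ (i : ℕ) (b : B i),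
      Filter.Tendsto (fun j => ‖iterMap (fun i => ⇑(ψ i)) i j b‖) Filter.atTop
        (nhds ‖ν i b‖))
    (ηL : G → L → L) (hηL : IsGlobalAction ηL)
    (hηLν : ∀ (i : ℕ) (g : G) (b : B i), ηL g (ν i b) = ν i (η i g b)) :
    closure (Submodule.span ℂ (⋃ g : G, ηL g '' closure (⋃ i, ν i '' SA i)) : Set L) =
      Set.univ := by
  have hcont (i : ℕ) : Continuous (ν i) := AddMonoidHomClass.continuous_of_bound (ν i) 1 fun x => by
    simpa using NonUnitalStarAlgHom.norm_apply_le (ν i) x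
  rw [← Set.univ_subset_iff, ← hdense]
  refine closure_minimal (Set.iUnion_subset fun i => ?_) isClosed_closure
  rintro _ ⟨b, rfl⟩
  have hb : b ∈ closure (Submodule.span ℂ (⋃ g : G, η i g '' SA i) : Set (B i)) :=
    (hglob i).2.2 ▸ Set.mem_univ b
  refine map_mem_closure (hcont i) hb fun x hx => ?_
  let f : B i →ₗ[ℂ] L := (ν i : B i →ₗ[ℂ] L)
  have hle : Submodule.span ℂ (⋃ g : G, η i g '' SA i) ≤
      (Submodule.span ℂ (⋃ g : G, ηL g '' closure (⋃ i, ν i '' SA i))).comap f := by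
    refine Submodule.span_le.mpr (Set.iUnion_subset fun g => ?_)
    rintro _ ⟨a, ha, rfl⟩
    refine Submodule.subset_span (Set.mem_iUnion.mpr ⟨g, ν i a, ?_, hηLν i g a⟩)
    exact subset_closure (Set.mem_iUnion.mpr ⟨i, a, ha, rfl⟩)
  exact hle hx
end
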